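/- arXiv:2102.05168 — 2 statements merged into one kernel-verified Lean document; each statement's English description precedes it below -/
import Mathlib

section
/- There is a universal constant C such that for every weighted graph G=(V,E,w) on n ≥ 2 vertices with all edge weights at least 1 and every root r ∈ V, there exists a well-separated (C·log n)-approximate copy tree embedding of (G,r) with copy number at most C·n·log n. -/
/-- An edge set `F` connects vertices `u` and `v` if they lie in the same connected
component of the graph with edge set `F`. -/
def EdgeConn {V : Type*} (F : Set (Sym2 V)) (u v : V) : Prop :=
  (SimpleGraph.fromEdgeSet F).Reachable u v

/-- Vertex sets `U` and `W` are connected by the edge set `F` if some `u ∈ U` and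
some `w ∈ W` are connected by `F`. -/
def SetConn {V : Type*} (F : Set (Sym2 V)) (U W : Set V) : Prop :=
  ∃ u ∈ U, ∃ w ∈ W, EdgeConn F u w

/-- A rooted weighted tree is well-separated if every child edge has weight at most
half the weight of its parent edge.  Here the edge `{b,c}` is a child edge of `{a,b}`
when `b` is the endpoint of `{a,b}` farther from the root and `c` is farther still. -/
def WellSeparated {V : Type*} (T : SimpleGraph V) (root : V) (w : Sym2 V → ℝ) : Prop :=
  ∀ a b c : V, T.Adj a b → T.Adj b c →
    T.dist root b = T.dist root a + 1 → T.dist root c = T.dist root b + 1 →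
    w s(b, c) ≤ w s(a, b) / 2

/-- An `α`-approximate copy tree embedding of the weighted graph `(G, w)` with root `r`:
a weighted rooted tree together with a copy mapping and monotone edge-mapping functions
that preserve connectivity and `α`-approximately preserve cost. -/
structure CopyTreeEmbedding (V V' : Type*) (G : SimpleGraph V) (w : Sym2 V → ℝ)
    (r : V) (α : ℝ) where
  tree : SimpleGraph V'
  isTree : tree.IsTree
  w' : Sym2 V' → ℝ
  root : V'
  copies : V → Set V'
  copies_nonempty : ∀ v : V, (copies v).Nonempty
  copies_disjoint : ∀ u v : V, u ≠ v → Disjoint (copies u) (copies v)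
  copies_cover : ∀ v' : V', ∃ v : V, v' ∈ copies v
  copies_root : copies r = {root}
  mapGT : Finset (Sym2 V) → Finset (Sym2 V')
  mapTG : Finset (Sym2 V') → Finset (Sym2 V)
  mapGT_sub : ∀ F : Finset (Sym2 V), ↑F ⊆ G.edgeSet → ↑(mapGT F) ⊆ tree.edgeSet
  mapTG_sub : ∀ F' : Finset (Sym2 V'), ↑F' ⊆ tree.edgeSet → ↑(mapTG F') ⊆ G.edgeSet
  mapTG_mono : ∀ A B : Finset (Sym2 V'), A ⊆ B → mapTG A ⊆ mapTG B
  conn_GT : ∀ F : Finset (Sym2 V), ↑F ⊆ G.edgeSet → ∀ u v : V,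
      EdgeConn (↑F) u v → SetConn (↑(mapGT F)) (copies u) (copies v)
  conn_TG : ∀ F' : Finset (Sym2 V'), ↑F' ⊆ tree.edgeSet →
      ∀ (u v : V) (u' v' : V'), u' ∈ copies u → v' ∈ copies v →
      EdgeConn (↑F') u' v' → EdgeConn (↑(mapTG F')) u v
  cost_GT : ∀ F : Finset (Sym2 V), ↑F ⊆ G.edgeSet →
      ∑ e ∈ mapGT F, w' e ≤ α * ∑ e ∈ F, w e
  cost_TG : ∀ F' : Finset (Sym2 V'), ↑F' ⊆ tree.edgeSet →
      ∑ e ∈ mapTG F', w e ≤ ∑ e ∈ F', w' e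

open Finset in
/-- Some ranking of `S` meets, in total weight, the value expected for a uniformly random ranking
of the event that the first element of `N e` lies in `X e`. -/
theorem exists_rank_sum_first_mem_le {V E : Type*} [DecidableEq V] (c : E → ℝ)
    (hc : ∀ e, 0 ≤ c e) (N X : E → Finset V) (hX : ∀ e, X e ⊆ N e) :
    ∀ (n : ℕ) (S : Finset V) (J : Finset E), #S = n → (∀ e ∈ J, N e ⊆ S) →
      ∃ σ : V → ℕ, Set.InjOn σ S ∧
        ∀ D ⊆ J, (∀ e ∈ D, ∃ x ∈ X e, ∀ y ∈ N e, σ x ≤ σ y) →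
          ∑ e ∈ D, c e ≤ ∑ e ∈ J, c e * (#(X e) / #(N e) : ℝ) := by
  classical
  intro n
  induction n with
  | zero =>
    intro S J hS hN
    rw [card_eq_zero] at hS
    subst hS
    refine ⟨fun _ => 0, by simp, fun D hD hcut => ?_⟩
    rw [sum_eq_zero fun e he => ?_]
    · exact sum_nonneg fun e _ => mul_nonneg (hc e) (by positivity)
    · obtain ⟨x, hx, -⟩ := hcut e he
      simpa using hN e (hD he) (hX e hx)
  | succ n ih =>
    intro S J hS hN
    have hne : S.Nonempty := card_pos.1 (by omega)
    let Φ : V → ℝ := fun x => ∑ e ∈ J, c e *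
      ((if x ∈ X e then 1 else 0) + if x ∈ N e then 0 else (#(X e) / #(N e) : ℝ))
    have havg : ∑ x ∈ S, Φ x ≤ ∑ x ∈ S, ∑ e ∈ J, c e * (#(X e) / #(N e) : ℝ) := by
      rw [sum_comm, sum_comm (s := S)]
      refine sum_le_sum fun e he => ?_
      rw [← mul_sum, sum_const, nsmul_eq_mul, mul_left_comm]
      refine mul_le_mul_of_nonneg_left (le_of_eq ?_) (hc e)
      rw [sum_add_distrib, sum_boole, sum_ite, sum_const_zero, zero_add, sum_const, nsmul_eq_mul,
        filter_mem_eq_inter, inter_eq_right.2 ((hX e).trans (hN e he)), ← sdiff_eq_filter,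
        card_sdiff_of_subset (hN e he), Nat.cast_sub (card_le_card (hN e he))]
      rcases (N e).eq_empty_or_nonempty with h0 | h0
      · have : X e = ∅ := subset_empty.1 (h0 ▸ hX e)
        simp [h0, this]
      · have : (#(N e) : ℝ) ≠ 0 := by exact_mod_cast (card_pos.2 h0).ne'
        field_simp
        ring
    obtain ⟨x, hxS, hx⟩ := exists_le_of_sum_le hne havg
    obtain ⟨σ, hσ, hle⟩ := ih (S.erase x) (J.filter fun e => x ∉ N e)
      (by rw [card_erase_of_mem hxS]; omega) (by
        intro e he y hy
        rw [mem_filter] at he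
        exact mem_erase.2 ⟨fun h => he.2 (h ▸ hy), hN e he.1 hy⟩)
    refine ⟨fun y => if y = x then 0 else σ y + 1, ?_, fun D hD hcut => le_trans ?_ hx⟩
    · intro y hy z hz hyz
      simp only at hyz
      split_ifs at hyz with h1 h2 h2
      · rw [h1, h2]
      · exact hσ (mem_coe.2 (mem_erase.2 ⟨h1, hy⟩)) (mem_coe.2 (mem_erase.2 ⟨h2, hz⟩)) (by omega)
    · have hsplit : Φ x = (∑ e ∈ J with x ∈ X e, c e) +
          ∑ e ∈ J with x ∉ N e, c e * (#(X e) / #(N e) : ℝ) := by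
        rw [sum_filter, sum_filter, ← sum_add_distrib]
        refine sum_congr rfl fun e _ => ?_
        by_cases h1 : x ∈ X e <;> by_cases h2 : x ∈ N e <;> simp [h1, h2, mul_add]
      rw [hsplit, ← sum_filter_add_sum_filter_not D (fun e => x ∈ N e)]
      refine add_le_add (sum_le_sum_of_subset_of_nonneg (fun e he => ?_) fun e _ _ => hc e)
        (hle _ (filter_subset_filter _ hD) fun e he => ?_)
      · rw [mem_filter] at he ⊢
        obtain ⟨z, hz, hmin⟩ := hcut e he.1
        have := hmin x he.2
        by_cases hzx : z = x
        · exact ⟨hD he.1, hzx ▸ hz⟩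
        · simp [hzx] at this
      · rw [mem_filter] at he
        obtain ⟨z, hz, hmin⟩ := hcut e he.1
        refine ⟨z, hz, fun y hy => ?_⟩
        have hy' : y ≠ x := fun h => he.2 (h ▸ hy)
        have hz' : z ≠ x := fun h => he.2 (h ▸ hX e hz)
        simpa [hy', hz'] using hmin y hy

theorem integral_shift_sub_shift_le {L : ℝ → ℝ} (hL : Monotone L) (a b : ℝ) {w : ℝ}
    (hw : 0 ≤ w) :
    ∫ x in a..b, (L (x + w) - L (x - w)) ≤ 2 * w * (L (b + w) - L (a - w)) := by
  have hi : ∀ x y, IntervalIntegrable L MeasureTheory.volume x y :=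
    fun x y => hL.intervalIntegrable
  have h1 : IntervalIntegrable (fun x => L (x + w)) MeasureTheory.volume a b :=
    Monotone.intervalIntegrable fun x y h => hL (by linarith)
  have h2 : IntervalIntegrable (fun x => L (x - w)) MeasureTheory.volume a b :=
    Monotone.intervalIntegrable fun x y h => hL (by linarith)
  rw [intervalIntegral.integral_sub h1 h2, intervalIntegral.integral_comp_add_right,
    intervalIntegral.integral_comp_sub_right]
  have e1 := intervalIntegral.integral_add_adjacent_intervals (hi (a - w) (a + w)) (hi (a + w) (b + w))
  have e2 := intervalIntegral.integral_add_adjacent_intervals (hi (a - w) (b - w)) (hi (b - w) (b + w))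
  have u : ∫ x in (b - w)..(b + w), L x ≤ ∫ x in (b - w)..(b + w), L (b + w) :=
    intervalIntegral.integral_mono_on (by linarith) (hi _ _) (by simp) fun x hx => hL hx.2
  have l : ∫ x in (a - w)..(a + w), L (a - w) ≤ ∫ x in (a - w)..(a + w), L x :=
    intervalIntegral.integral_mono_on (by linarith) (by simp) (hi _ _) fun x hx => hL hx.1
  rw [intervalIntegral.integral_const, smul_eq_mul] at u l
  linarith

/-- The number of points within distance `x` of `a`. -/
noncomputable def ballCard {V : Type*} (d : V → V → ℝ) (a : V) (x : ℝ) : ℕ :=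
  {y | d a y ≤ x}.ncard

section Partition

variable {V : Type*} [Finite V] {d : V → V → ℝ}

theorem ballCard_mono (a : V) : Monotone (ballCard d a) := fun _ _ h =>
  Set.ncard_le_ncard fun _ hy => le_trans hy h

theorem one_le_ballCard (d_self : ∀ a, d a a = 0) (a : V) {x : ℝ} (hx : 0 ≤ x) :
    1 ≤ ballCard d a x :=
  (Set.ncard_pos).2 ⟨a, by simpa [d_self] using hx⟩

theorem log_ballCard_mono (a : V) : Monotone fun x => Real.log (ballCard d a x) := by
  intro x y h
  have := ballCard_mono (d := d) a h
  rcases Nat.eq_zero_or_pos (ballCard d a x) with h0 | h0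
  · simpa [h0] using Real.log_natCast_nonneg _
  · exact Real.log_le_log (by exact_mod_cast h0) (by exact_mod_cast this)

open Finset in
/-- Clusters of radius `ρ` whose cut weight is controlled by the growth of balls around `ρ`. -/
theorem exists_clustering [DecidableEq V] (d_self : ∀ a, d a a = 0) (d_symm : ∀ a b, d a b = d b a)
    (d_tri : ∀ a b x, d a x ≤ d a b + d b x) (c : V × V → ℝ) (hc : ∀ q, 0 ≤ c q)
    (J : Finset (V × V)) {ρ : ℝ} (hρ : 0 ≤ ρ) (hJ : ∀ q ∈ J, d q.1 q.2 ≤ ρ) :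
    ∃ κ : V → V, (∀ a, d a (κ a) ≤ ρ) ∧
      (∑ q ∈ J with κ q.1 ≠ κ q.2, c q) ≤
        ∑ q ∈ J, c q * (Real.log (ballCard d q.1 (ρ + d q.1 q.2)) -
          Real.log (ballCard d q.1 (ρ - d q.1 q.2))) := by
  classical
  have := Fintype.ofFinite V
  let B : V → Finset V := fun a => univ.filter fun y => d a y ≤ ρ
  have hB : ∀ a y, y ∈ B a ↔ d a y ≤ ρ := fun a y => by simp [B]
  obtain ⟨σ, hσ, hle⟩ := exists_rank_sum_first_mem_le c hc (fun q => B q.1 ∪ B q.2)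
    (fun q => (B q.1 ∪ B q.2) \ (B q.1 ∩ B q.2)) (fun q => sdiff_subset) _ univ J rfl
    (fun _ _ => subset_univ _)
  have hBne : ∀ a, (B a).Nonempty := fun a => ⟨a, (hB a a).2 (by rwa [d_self])⟩
  choose κ hκB hκ using fun a => exists_min_image (B a) σ (hBne a)
  refine ⟨κ, fun a => (hB _ _).1 (hκB a), ?_⟩
  refine (hle _ (filter_subset _ _) ?_).trans ?_
  · rintro ⟨a, b⟩ hq
    rw [mem_filter] at hq
    obtain ⟨x, hx, hmin⟩ := exists_min_image (B a ∪ B b) σ ((hBne a).mono subset_union_left)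
    refine ⟨x, mem_sdiff.2 ⟨hx, fun hxi => hq.2 ?_⟩, hmin⟩
    rw [mem_inter] at hxi
    have key : ∀ z, B z ⊆ B a ∪ B b → x ∈ B z → κ z = x := fun z hz hxz =>
      hσ (by simp) (by simp) (le_antisymm (hκ z x hxz) (hmin _ (hz (hκB z))))
    exact (key a subset_union_left hxi.1).trans (key b subset_union_right hxi.2).symm
  · refine sum_le_sum fun q hq => mul_le_mul_of_nonneg_left ?_ (hc q)
    obtain ⟨a, b⟩ := q
    have hab := hJ _ hq
    simp only at hab ⊢
    set N := B a ∪ B b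
    set M := B a ∩ B b
    have hMN : M ⊆ N := inter_subset_left.trans subset_union_left
    have hM1 : ballCard d a (ρ - d a b) ≤ #M := by
      rw [ballCard, ← Set.ncard_coe_finset]
      refine Set.ncard_le_ncard fun y hy => ?_
      simp only [Set.mem_ofPred_eq] at hy
      have h0 : 0 ≤ d a b := by
        have := d_tri a b a
        rw [d_self, d_symm b a] at this
        linarith
      have := d_tri b a y
      rw [d_symm b a] at this
      simp only [M, mem_coe, mem_inter, hB]
      constructor <;> linarith
    have hN1 : #N ≤ ballCard d a (ρ + d a b) := by
      rw [ballCard, ← Set.ncard_coe_finset]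
      refine Set.ncard_le_ncard fun y hy => ?_
      have h0 : 0 ≤ d a b := by
        have := d_tri a b a
        rw [d_self, d_symm b a] at this
        linarith
      have := d_tri a b y
      simp only [N, mem_coe, mem_union, hB] at hy
      simp only [Set.mem_ofPred_eq]
      rcases hy with hy | hy <;> linarith
    have hpos := one_le_ballCard d_self a (sub_nonneg.2 hab)
    have hb : (0 : ℝ) < ballCard d a (ρ - d a b) := by exact_mod_cast hpos
    have hMpos : (0 : ℝ) < #M := by exact_mod_cast hpos.trans hM1
    have hNpos : (0 : ℝ) < #N := by exact_mod_cast (hpos.trans hM1).trans (card_le_card hMN)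
    rw [card_sdiff_of_subset hMN, Nat.cast_sub (card_le_card hMN)]
    have h1 := Real.one_sub_inv_le_log_of_pos (div_pos hNpos hMpos)
    rw [Real.log_div hNpos.ne' hMpos.ne', inv_div] at h1
    have h2 := Real.log_le_log hb (Nat.cast_le.2 hM1)
    have h3 := Real.log_le_log hNpos (Nat.cast_le.2 hN1)
    rw [sub_div, div_self hNpos.ne']
    linarith

open Finset in
/-- A partition into clusters of diameter `4 * R` with small total cut weight. -/
theorem exists_partition [DecidableEq V] (d_self : ∀ a, d a a = 0) (d_symm : ∀ a b, d a b = d b a)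
    (d_tri : ∀ a b x, d a x ≤ d a b + d b x) (c : V × V → ℝ) (hc : ∀ q, 0 ≤ c q)
    (J : Finset (V × V)) {R : ℝ} (hR : 0 < R) :
    ∃ κ : V → V, (∀ a b, κ a = κ b → d a b ≤ 4 * R) ∧
      (∑ q ∈ J with κ q.1 ≠ κ q.2, c q) ≤
        ∑ q ∈ J, c q * (2 * d q.1 q.2 / R * (Real.log (ballCard d q.1 (4 * R)) -
          Real.log (ballCard d q.1 (R / 2))) + if R < 2 * d q.1 q.2 then 1 else 0) := by
  classical
  have d0 : ∀ a b, 0 ≤ d a b := fun a b => by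
    have := d_tri a b a
    rw [d_self, d_symm b a] at this
    linarith
  let J' := J.filter fun q => 2 * d q.1 q.2 ≤ R
  let L : V → ℝ → ℝ := fun a x => Real.log (ballCard d a x)
  have hL : ∀ a, Monotone (L a) := fun a => log_ballCard_mono a
  let h : ℝ → ℝ := fun ρ => ∑ q ∈ J', c q * (L q.1 (ρ + d q.1 q.2) - L q.1 (ρ - d q.1 q.2))
  let b : ℝ := ∑ q ∈ J', c q * (2 * d q.1 q.2 / R * (L q.1 (4 * R) - L q.1 (R / 2)))
  have hint : ∀ q : V × V, IntervalIntegrable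
      (fun ρ => c q * (L q.1 (ρ + d q.1 q.2) - L q.1 (ρ - d q.1 q.2)))
      MeasureTheory.volume R (2 * R) := fun q =>
    (IntervalIntegrable.sub (Monotone.intervalIntegrable fun x y hxy => hL _ (by linarith))
      (Monotone.intervalIntegrable fun x y hxy => hL _ (by linarith))).const_mul _
  have hh : IntervalIntegrable h MeasureTheory.volume R (2 * R) := by
    simpa only [h, Finset.sum_fn] using IntervalIntegrable.sum J' (fun q _ => hint q)
  have hle : ∫ ρ in R..(2 * R), h ρ ≤ R * b := by
    simp only [h, b]
    rw [intervalIntegral.integral_finsetSum fun q _ => hint q, mul_sum]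
    refine sum_le_sum fun q hq => ?_
    have hq2 := (mem_filter.1 hq).2
    rw [intervalIntegral.integral_const_mul, mul_left_comm]
    refine mul_le_mul_of_nonneg_left ?_ (hc q)
    refine (integral_shift_sub_shift_le (hL _) _ _ (d0 _ _)).trans ?_
    have e : R * (2 * d q.1 q.2 / R * (L q.1 (4 * R) - L q.1 (R / 2))) =
      2 * d q.1 q.2 * (L q.1 (4 * R) - L q.1 (R / 2)) := by field_simp
    rw [e]
    refine mul_le_mul_of_nonneg_left (sub_le_sub (hL _ ?_) (hL _ ?_)) (by linarith [d0 q.1 q.2])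
    · linarith
    · linarith
  obtain ⟨ρ, hρ, hρb⟩ : ∃ ρ ∈ Set.Ioo R (2 * R), h ρ ≤ b := by
    by_contra! hcon
    have := intervalIntegral.intervalIntegral_pos_of_pos_on (f := fun x => h x - b)
      (hh.sub (by simp)) (fun x hx => sub_pos.2 (hcon x hx)) (by linarith)
    rw [intervalIntegral.integral_sub hh (by simp), intervalIntegral.integral_const,
      smul_eq_mul] at this
    linarith
  obtain ⟨κ, hκ, hcut⟩ := exists_clustering d_self d_symm d_tri c hc J' (ρ := ρ)
    (by linarith [hρ.1]) (fun q hq => by linarith [hρ.1, (mem_filter.1 hq).2, d0 q.1 q.2])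
  refine ⟨κ, fun x y hxy => ?_, ?_⟩
  · have h1 := hκ x
    have h2 := hκ y
    have h3 := d_tri x (κ x) y
    rw [hxy, d_symm (κ y) y, ← hxy] at h3
    rw [← hxy] at h2
    linarith [hρ.2]
  · have hcut' := hcut.trans hρb
    simp only [mul_add, sum_add_distrib]
    rw [← sum_filter_add_sum_filter_not (J.filter _) (fun q => 2 * d q.1 q.2 ≤ R)]
    refine add_le_add ?_ ?_
    · rw [filter_comm]
      refine hcut'.trans (sum_le_sum_of_subset_of_nonneg (filter_subset _ _) fun q _ _ => ?_)
      exact mul_nonneg (hc q) (mul_nonneg (div_nonneg (by linarith [d0 q.1 q.2]) hR.le)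
        (sub_nonneg.2 (hL _ (by linarith))))
    · rw [filter_filter]
      simp only [mul_ite, mul_one, mul_zero]
      rw [← sum_filter]
      refine sum_le_sum_of_subset_of_nonneg (fun q hq => ?_) fun q _ _ => hc q
      rw [mem_filter] at hq ⊢
      exact ⟨hq.1, not_le.1 hq.2.2⟩

end Partition

section EdgeConn

variable {V : Type*} {F F' : Set (Sym2 V)} {u v x : V}

theorem EdgeConn.refl (F : Set (Sym2 V)) (u : V) : EdgeConn F u u :=
  SimpleGraph.Reachable.refl u

theorem EdgeConn.symm (h : EdgeConn F u v) : EdgeConn F v u :=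
  SimpleGraph.Reachable.symm h

theorem EdgeConn.trans (h : EdgeConn F u v) (h' : EdgeConn F v x) : EdgeConn F u x :=
  SimpleGraph.Reachable.trans h h'

theorem EdgeConn.mono (hF : F ⊆ F') (h : EdgeConn F u v) : EdgeConn F' u v :=
  SimpleGraph.Reachable.mono (SimpleGraph.fromEdgeSet_mono hF) h

theorem EdgeConn.of_mem (h : s(u, v) ∈ F) : EdgeConn F u v := by
  by_cases huv : u = v
  · exact huv ▸ EdgeConn.refl F u
  · exact SimpleGraph.Adj.reachable ((SimpleGraph.fromEdgeSet_adj F).2 ⟨h, huv⟩)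

/-- A relation that is reflexive, transitive and holds along edges holds between connected
vertices. -/
theorem EdgeConn.induction {W : Type*} {H : Set (Sym2 W)} (f : V → W)
    (hf : ∀ a b, s(a, b) ∈ F → EdgeConn H (f a) (f b)) (h : EdgeConn F u v) :
    EdgeConn H (f u) (f v) := by
  obtain ⟨p⟩ := h
  induction p with
  | nil => exact EdgeConn.refl H _
  | cons hadj _ ih => exact (hf _ _ ((SimpleGraph.fromEdgeSet_adj F).1 hadj).1).trans ih

end EdgeConn

/-- A tree on `V` rooted at `r`, given by parents `par`, in which the edge above `v` has weight
`2 ^ lev v`, levels increase towards the root, tree edges dominate `d`, and `cost a b` bounds the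
weight of some set of tree edges connecting `a` and `b`. -/
structure LevelTree {V : Type*} (d : V → V → ℝ) (r : V) (K : ℕ) where
  par : V → V
  lev : V → ℕ
  cost : V → V → ℝ
  lev_root : lev r = K + 1
  lev_le : ∀ v, lev v ≤ K + 1
  lev_lt : ∀ v ≠ r, lev v < lev (par v)
  dist_le : ∀ v ≠ r, d v (par v) ≤ 2 ^ lev v
  cost_self : ∀ v, cost v v = 0
  link : ∀ a b, ∃ A : Finset V, r ∉ A ∧ ∑ v ∈ A, (2 : ℝ) ^ lev v ≤ cost a b ∧
    EdgeConn ((fun v => s(v, par v)) '' A) a b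

/-- An ultrametric with integer levels yields a tree on the same vertices by contracting each ball
of the ultrametric to its first element. -/
theorem exists_levelTree_of_ultrametric {V : Type*} [Finite V] [DecidableEq V] {d : V → V → ℝ}
    (r : V) (K : ℕ) (ℓ : V → V → ℕ) (ℓ_zero : ∀ a b, ℓ a b = 0 ↔ a = b)
    (ℓ_symm : ∀ a b, ℓ a b = ℓ b a) (ℓ_tri : ∀ a b c, ℓ a c ≤ max (ℓ a b) (ℓ b c))
    (ℓ_le : ∀ a b, ℓ a b ≤ K) (hd : ∀ a b, d a b ≤ 2 ^ ℓ a b) :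
    ∃ T : LevelTree d r K, ∀ a b, T.cost a b = if a = b then 0 else 4 * 2 ^ ℓ a b := by
  have := Fintype.ofFinite V
  obtain ⟨rk, rk_inj, rk_root⟩ : ∃ rk : V → ℕ, Function.Injective rk ∧ rk r = 0 := by
    refine ⟨fun v => if v = r then 0 else (Fintype.equivFin V v : ℕ) + 1, fun a b hab => ?_,
      by simp⟩
    simp only at hab
    split_ifs at hab with h1 h2 h2
    · rw [h1, h2]
    · exact (Fintype.equivFin V).injective (Fin.ext (by omega))
  have ℓ_self : ∀ a, ℓ a a = 0 := fun a => (ℓ_zero a a).2 rfl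
  have hm : ∀ (a : V) (i : ℕ), ∃ m, ℓ a m ≤ i ∧ ∀ b, ℓ a b ≤ i → rk m ≤ rk b := by
    intro a i
    obtain ⟨m, hm1, hm2⟩ := Finset.exists_min_image (Finset.univ.filter fun b => ℓ a b ≤ i) rk
      ⟨a, by simp [ℓ_self]⟩
    exact ⟨m, by simpa using hm1, fun b hb => hm2 b (by simpa using hb)⟩
  choose m m_le m_min using hm
  have m_congr : ∀ a b i, ℓ a b ≤ i → m a i = m b i := fun a b i hab =>
    rk_inj (le_antisymm
      (m_min a i _ ((ℓ_tri a b _).trans (max_le hab (m_le b i))))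
      (m_min b i _ ((ℓ_tri b a _).trans (max_le (ℓ_symm a b ▸ hab) (m_le a i)))))
  have m_idem : ∀ a i s, s ≤ i → m (m a i) s = m a i := fun a i s hs => by
    refine rk_inj (le_antisymm (m_min _ _ _ (by simp [ℓ_self])) (m_min a i _ ?_))
    exact (ℓ_tri _ _ _).trans (max_le (m_le a i) ((m_le _ s).trans hs))
  have m_zero : ∀ a, m a 0 = a := fun a => ((ℓ_zero _ _).1 (Nat.le_zero.1 (m_le a 0))).symm
  have m_root : ∀ i, m r i = r := fun i =>
    rk_inj (le_antisymm (m_min r i r (by simp [ℓ_self])) (by simp [rk_root]))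
  have m_top : ∀ a, m a K = r := fun a => (m_congr a r K (ℓ_le a r)).trans (m_root K)
  have hlev : ∀ v, ∃ t, (v = r → t = K + 1) ∧
      (v ≠ r → t ≤ K ∧ m v t ≠ v ∧ ∀ s < t, m v s = v) := by
    intro v
    by_cases hv : v = r
    · exact ⟨K + 1, fun _ => rfl, fun h => absurd hv h⟩
    · have hex : ∃ t, m v t ≠ v := ⟨K, by rw [m_top]; exact Ne.symm hv⟩
      exact ⟨Nat.find hex, fun h => absurd h hv, fun _ => ⟨Nat.find_min' hex
        (by rw [m_top]; exact Ne.symm hv), Nat.find_spec hex,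
        fun s hs => not_not.1 (Nat.find_min hex hs)⟩⟩
  choose lev lev_root lev_spec using hlev
  have climb : ∀ a i, ∃ A : Finset V, r ∉ A ∧ ∑ v ∈ A, (2 : ℝ) ^ lev v ≤ 2 ^ (i + 1) ∧
      EdgeConn ((fun v => s(v, m v (lev v))) '' A) a (m a i) := by
    intro a i
    induction i with
    | zero => exact ⟨∅, by simp, by simp, by rw [m_zero]; exact EdgeConn.refl _ _⟩
    | succ i ih =>
      obtain ⟨A, hA, hsum, hconn⟩ := ih
      by_cases heq : m a (i + 1) = m a i
      · exact ⟨A, hA, hsum.trans (pow_le_pow_right₀ one_le_two (by omega)), heq ▸ hconn⟩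
      set x := m a i with hx
      have hup : m a (i + 1) = m x (i + 1) := m_congr _ _ _ ((m_le a i).trans (by omega))
      have hxr : x ≠ r := fun h => heq (by rw [hup, h, m_root])
      obtain ⟨-, h2, h3⟩ := lev_spec x hxr
      have hlx : lev x = i + 1 := by
        refine le_antisymm (not_lt.1 fun h => heq (hup.trans (h3 _ h))) (not_lt.1 fun h => h2 ?_)
        exact m_idem a i _ (by omega)
      refine ⟨insert x A, ?_, ?_, ?_⟩
      · simp [hA, Ne.symm hxr]
      · have : ∑ v ∈ insert x A, (2 : ℝ) ^ lev v ≤ 2 ^ lev x + ∑ v ∈ A, (2 : ℝ) ^ lev v := by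
          by_cases hxA : x ∈ A
          · rw [Finset.insert_eq_of_mem hxA]
            exact le_add_of_nonneg_left (by positivity)
          · rw [Finset.sum_insert hxA]
        rw [hlx] at this
        rw [pow_succ _ (i + 1)]
        linarith
      · refine (hconn.mono (Set.image_mono (by simp))).trans (EdgeConn.of_mem ⟨x, by simp, ?_⟩)
        simp only [hlx, hup]
  refine ⟨{ par := fun v => m v (lev v), lev := lev,
            cost := fun a b => if a = b then 0 else 4 * 2 ^ ℓ a b
            lev_root := lev_root r rfl
            lev_le := ?_, lev_lt := ?_, dist_le := ?_, cost_self := fun v => if_pos rfl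
            link := ?_ }, fun a b => rfl⟩
  · intro v
    by_cases hv : v = r
    · exact (lev_root v hv).le
    · exact (lev_spec v hv).1.trans (Nat.le_succ K)
  · intro v hv
    by_cases hp : m v (lev v) = r
    · rw [hp, lev_root r rfl]
      exact Nat.lt_succ_of_le (lev_spec v hv).1
    · exact not_le.1 fun h => (lev_spec _ hp).2.1 (m_idem v _ _ h)
  · exact fun v hv => (hd _ _).trans (pow_le_pow_right₀ one_le_two (m_le _ _))
  · intro a b
    by_cases hab : a = b
    · exact ⟨∅, by simp, by simp [hab], hab ▸ EdgeConn.refl _ _⟩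
    obtain ⟨A, hA, hAs, hAc⟩ := climb a (ℓ a b)
    obtain ⟨B, hB, hBs, hBc⟩ := climb b (ℓ a b)
    refine ⟨A ∪ B, by simp [hA, hB], ?_, ?_⟩
    · rw [if_neg hab]
      have := Finset.sum_union_inter (s₁ := A) (s₂ := B) (f := fun v => (2 : ℝ) ^ lev v)
      have h0 : 0 ≤ ∑ v ∈ A ∩ B, (2 : ℝ) ^ lev v := Finset.sum_nonneg fun _ _ => by positivity
      rw [pow_succ] at hAs hBs
      linarith
    · rw [m_congr a b _ le_rfl] at hAc
      exact (hAc.mono (Set.image_mono (by simp))).trans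
        (hBc.mono (Set.image_mono (by simp))).symm

theorem sum_range_shift_sub_le {u : ℕ → ℝ} {b : ℝ} (h0 : ∀ i, 0 ≤ u i) (hb : ∀ i, u i ≤ b)
    (K : ℕ) : ∑ j ∈ Finset.range K, (u (j + 3) - u j) ≤ 3 * b := by
  have : ∑ j ∈ Finset.range K, (u (j + 3) - u j) =
      u K + u (K + 1) + u (K + 2) - u 0 - u 1 - u 2 := by
    induction K with
    | zero => rw [Finset.sum_range_zero]; ring
    | succ K ih => rw [Finset.sum_range_succ, ih]; ring
  rw [this]
  linarith [h0 0, h0 1, h0 2, hb K, hb (K + 1), hb (K + 2)]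

theorem sum_range_two_pow_lt_le {x : ℝ} (hx : 0 ≤ x) (K : ℕ) :
    ∑ j ∈ Finset.range K, (if (2 : ℝ) ^ j < x then (2 : ℝ) ^ j else 0) ≤ min (2 ^ K) (2 * x) := by
  induction K with
  | zero => simpa using hx
  | succ K ih =>
    rw [Finset.sum_range_succ]
    have h1 := ih.trans (min_le_left _ _)
    have h2 := ih.trans (min_le_right _ _)
    have h3 : (0 : ℝ) < 2 ^ K := by positivity
    rw [pow_succ]
    split_ifs with h
    · exact le_min (by linarith) (by linarith)
    · exact le_min (by linarith) (by linarith)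

section Ultrametric

variable {V : Type*} [Fintype V] {d : V → V → ℝ}

theorem half_le_log_card (hV : 2 ≤ Fintype.card V) : 1 / 2 ≤ Real.log (Fintype.card V) := by
  have h1 := Real.log_two_gt_d9
  have h2 := Real.log_le_log two_pos (show (2 : ℝ) ≤ Fintype.card V by exact_mod_cast hV)
  linarith

theorem sum_cut_bound_le (d_self : ∀ a, d a a = 0) (hV : 2 ≤ Fintype.card V) (a : V) {x : ℝ}
    (hx : 0 ≤ x) (K : ℕ) :
    ∑ j ∈ Finset.range K, (2 : ℝ) ^ j * (2 * x / (2 ^ j / 8) *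
      (Real.log (ballCard d a (4 * (2 ^ j / 8))) - Real.log (ballCard d a (2 ^ j / 8 / 2))) +
        if (2 : ℝ) ^ j / 8 < 2 * x then 1 else 0) ≤ 112 * Real.log (Fintype.card V) * x := by
  let u : ℕ → ℝ := fun j => Real.log (ballCard d a (2 ^ j / 16))
  have hu0 : ∀ j, 0 ≤ u j := fun j => Real.log_natCast_nonneg _
  have huV : ∀ j, u j ≤ Real.log (Fintype.card V) := fun j => by
    refine Real.log_le_log ?_ ?_
    · exact_mod_cast one_le_ballCard d_self a (by positivity)
    · rw [Nat.cast_le, ballCard, ← Nat.card_eq_fintype_card]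
      exact Set.ncard_le_card _
  have h1 := sum_range_shift_sub_le hu0 huV K
  have h2 := (sum_range_two_pow_lt_le (x := 16 * x) (by linarith) K).trans (min_le_right _ _)
  have hterm : ∀ j ∈ Finset.range K, (2 : ℝ) ^ j * (2 * x / (2 ^ j / 8) *
      (Real.log (ballCard d a (4 * (2 ^ j / 8))) - Real.log (ballCard d a (2 ^ j / 8 / 2))) +
        if (2 : ℝ) ^ j / 8 < 2 * x then 1 else 0) =
      16 * x * (u (j + 3) - u j) + if (2 : ℝ) ^ j < 16 * x then (2 : ℝ) ^ j else 0 := by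
    intro j _
    have e1 : (4 : ℝ) * (2 ^ j / 8) = 2 ^ (j + 3) / 16 := by ring
    have e2 : (2 : ℝ) ^ j / 8 / 2 = 2 ^ j / 16 := by ring
    have e3 : (2 : ℝ) ^ j / 8 < 2 * x ↔ (2 : ℝ) ^ j < 16 * x := by
      constructor <;> intro h <;> linarith
    rw [e1, e2, mul_add]
    simp only [e3, mul_ite, mul_one, mul_zero]
    congr 1
    simp only [u]
    field_simp
    ring
  rw [Finset.sum_congr rfl hterm, Finset.sum_add_distrib, ← Finset.mul_sum]
  have h3 := mul_le_mul_of_nonneg_left h1 (show 0 ≤ 16 * x by linarith)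
  have h4 := mul_le_mul_of_nonneg_right (half_le_log_card hV) hx
  linarith

open Finset in
/-- For every weighting of the pairs, some ultrametric dominates `d` with average stretch
logarithmic in the number of points. -/
theorem exists_ultrametric [DecidableEq V] (d_self : ∀ a, d a a = 0)
    (d_symm : ∀ a b, d a b = d b a) (d_tri : ∀ a b x, d a x ≤ d a b + d b x)
    (d_one : ∀ a b, a ≠ b → 1 ≤ d a b) (hV : 2 ≤ Fintype.card V) {K : ℕ} (hK : 1 ≤ K)
    (d_le : ∀ a b, d a b ≤ 2 ^ K) (c : V × V → ℝ) (hc : ∀ q, 0 ≤ c q) :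
    ∃ ℓ : V → V → ℕ, (∀ a b, ℓ a b = 0 ↔ a = b) ∧ (∀ a b, ℓ a b = ℓ b a) ∧
      (∀ a b x, ℓ a x ≤ max (ℓ a b) (ℓ b x)) ∧ (∀ a b, ℓ a b ≤ K) ∧
      (∀ a b, d a b ≤ 2 ^ ℓ a b) ∧
      ∑ q, c q * (if q.1 = q.2 then 0 else 2 ^ ℓ q.1 q.2) ≤
        224 * Real.log (Fintype.card V) * ∑ q, c q * d q.1 q.2 := by
  have d0 : ∀ a b, 0 ≤ d a b := fun a b => by
    have := d_tri a b a
    rw [d_self, d_symm b a] at this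
    linarith
  choose κ hκ hcut using fun j : ℕ => exists_partition d_self d_symm d_tri c hc univ
    (show (0 : ℝ) < 2 ^ j / 8 by positivity)
  let P : ℕ → V → V → Prop := fun i a b => ∀ j, i ≤ j → j < K → κ j a = κ j b
  have hex : ∀ a b, ∃ i, P i a b := fun a b => ⟨K, fun j h1 h2 => absurd h2 (not_lt.2 h1)⟩
  classical
  let ℓ : V → V → ℕ := fun a b => Nat.find (hex a b)
  have hspec : ∀ a b, P (ℓ a b) a b := fun a b => Nat.find_spec (hex a b)
  have hmin : ∀ a b i, P i a b → ℓ a b ≤ i := fun a b i h => Nat.find_min' (hex a b) h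
  have hℓK : ∀ a b, ℓ a b ≤ K := fun a b => hmin a b K fun j h1 h2 => absurd h2 (not_lt.2 h1)
  have hdist : ∀ a b, d a b ≤ 2 ^ ℓ a b ∧ (ℓ a b = 0 → a = b) := by
    intro a b
    rcases (hℓK a b).lt_or_eq with h | h
    · have h1 := hκ _ _ _ (hspec a b _ le_rfl h)
      have h2 : (0 : ℝ) < 2 ^ ℓ a b := by positivity
      refine ⟨by linarith, fun h0 => by_contra fun hne => ?_⟩
      have := d_one a b hne
      rw [h0] at h1
      norm_num at h1
      linarith
    · exact ⟨h ▸ d_le a b, fun h0 => by omega⟩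
  have hsymm : ∀ a b, ℓ a b ≤ ℓ b a := fun a b =>
    hmin _ _ _ fun j h1 h2 => (hspec b a j h1 h2).symm
  refine ⟨ℓ, fun a b => ⟨(hdist a b).2, fun h => ?_⟩, fun a b => (hsymm a b).antisymm (hsymm b a),
    fun a b x => ?_, hℓK, fun a b => (hdist a b).1, ?_⟩
  · exact Nat.le_zero.1 (hmin _ _ _ fun j _ _ => h ▸ rfl)
  · exact hmin _ _ _ fun j h1 h2 => (hspec a b j (le_trans (le_max_left _ _) h1) h2).trans
      (hspec b x j (le_trans (le_max_right _ _) h1) h2)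
  have hpair : ∀ q : V × V, (if q.1 = q.2 then 0 else (2 : ℝ) ^ ℓ q.1 q.2) ≤
      ∑ j ∈ range K, 2 * 2 ^ j * (if κ j q.1 ≠ κ j q.2 then 1 else 0) := by
    rintro ⟨a, b⟩
    have hnn : ∀ j ∈ range K, (0 : ℝ) ≤ 2 * 2 ^ j * (if κ j a ≠ κ j b then 1 else 0) :=
      fun j _ => by split_ifs <;> positivity
    by_cases hab : a = b
    · simp only [hab, if_true]
      exact sum_nonneg (hab ▸ hnn)
    · have hpos : 0 < ℓ a b := Nat.pos_of_ne_zero fun h => hab ((hdist a b).2 h)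
      have hnot : ¬ P (ℓ a b - 1) a b := fun h => by
        have := hmin _ _ _ h
        omega
      simp only [P, not_forall] at hnot
      obtain ⟨j, h1, h2, h3⟩ := hnot
      rw [if_neg hab]
      refine le_trans ?_ (single_le_sum hnn (mem_range.2 h2))
      rw [if_pos h3, mul_one, ← pow_succ']
      exact pow_le_pow_right₀ one_le_two (by simp only; omega)
  calc ∑ q, c q * (if q.1 = q.2 then 0 else 2 ^ ℓ q.1 q.2)
      ≤ ∑ q : V × V, c q * ∑ j ∈ range K, 2 * 2 ^ j * (if κ j q.1 ≠ κ j q.2 then 1 else 0) :=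
        sum_le_sum fun q _ => mul_le_mul_of_nonneg_left (hpair q) (hc q)
    _ = ∑ j ∈ range K, 2 * 2 ^ j * ∑ q with κ j q.1 ≠ κ j q.2, c q := by
        simp_rw [mul_sum]
        rw [sum_comm]
        refine sum_congr rfl fun j _ => ?_
        rw [sum_filter]
        refine sum_congr rfl fun q _ => ?_
        split_ifs <;> ring
    _ ≤ ∑ j ∈ range K, 2 * 2 ^ j * ∑ q, c q * (2 * d q.1 q.2 / (2 ^ j / 8) *
          (Real.log (ballCard d q.1 (4 * (2 ^ j / 8))) -
            Real.log (ballCard d q.1 (2 ^ j / 8 / 2))) +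
          if (2 : ℝ) ^ j / 8 < 2 * d q.1 q.2 then 1 else 0) :=
        sum_le_sum fun j _ => mul_le_mul_of_nonneg_left (hcut j) (by positivity)
    _ = ∑ q : V × V, 2 * c q * ∑ j ∈ range K, 2 ^ j * (2 * d q.1 q.2 / (2 ^ j / 8) *
          (Real.log (ballCard d q.1 (4 * (2 ^ j / 8))) -
            Real.log (ballCard d q.1 (2 ^ j / 8 / 2))) +
          if (2 : ℝ) ^ j / 8 < 2 * d q.1 q.2 then 1 else 0) := by
        simp_rw [mul_sum (range K), mul_sum univ]
        rw [sum_comm]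
        exact sum_congr rfl fun q _ => sum_congr rfl fun j _ => by ring
    _ ≤ ∑ q : V × V, 2 * c q * (112 * Real.log (Fintype.card V) * d q.1 q.2) :=
        sum_le_sum fun q _ => mul_le_mul_of_nonneg_left
          (sum_cut_bound_le d_self hV q.1 (d0 _ _) K) (mul_nonneg two_pos.le (hc q))
    _ = 224 * Real.log (Fintype.card V) * ∑ q, c q * d q.1 q.2 := by
        rw [mul_sum]
        exact sum_congr rfl fun q _ => by ring

theorem exists_levelTree [DecidableEq V] (r : V) (d_self : ∀ a, d a a = 0)
    (d_symm : ∀ a b, d a b = d b a) (d_tri : ∀ a b x, d a x ≤ d a b + d b x)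
    (d_one : ∀ a b, a ≠ b → 1 ≤ d a b) (hV : 2 ≤ Fintype.card V) {K : ℕ} (hK : 1 ≤ K)
    (d_le : ∀ a b, d a b ≤ 2 ^ K) (c : V × V → ℝ) (hc : ∀ q, 0 ≤ c q) :
    ∃ T : LevelTree d r K, ∑ q, c q * T.cost q.1 q.2 ≤
      896 * Real.log (Fintype.card V) * ∑ q, c q * d q.1 q.2 := by
  obtain ⟨ℓ, h1, h2, h3, h4, h5, h6⟩ :=
    exists_ultrametric d_self d_symm d_tri d_one hV hK d_le c hc
  obtain ⟨T, hT⟩ := exists_levelTree_of_ultrametric r K ℓ h1 h2 h3 h4 h5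
  refine ⟨T, ?_⟩
  calc ∑ q, c q * T.cost q.1 q.2
      = 4 * ∑ q, c q * (if q.1 = q.2 then 0 else 2 ^ ℓ q.1 q.2) := by
        rw [Finset.mul_sum]
        refine Finset.sum_congr rfl fun q _ => ?_
        rw [hT]
        split_ifs <;> ring
    _ ≤ _ := by linarith

end Ultrametric

theorem Finset.sum_biUnion_le_of_nonneg {ι κ : Type*} [DecidableEq ι] (s : Finset κ)
    (t : κ → Finset ι) (f : ι → ℝ) (hf : ∀ k ∈ s, ∀ i ∈ t k, 0 ≤ f i) :
    ∑ i ∈ s.biUnion t, f i ≤ ∑ k ∈ s, ∑ i ∈ t k, f i := by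
  classical
  induction s using Finset.induction_on with
  | empty => simp
  | insert k s hk ih =>
    rw [Finset.biUnion_insert, Finset.sum_insert hk]
    have h1 := ih fun k hk => hf k (Finset.mem_insert_of_mem hk)
    have h2 := Finset.sum_union_inter (s₁ := t k) (s₂ := s.biUnion t) (f := f)
    have h3 : 0 ≤ ∑ i ∈ t k ∩ s.biUnion t, f i := Finset.sum_nonneg fun i hi =>
      hf k (Finset.mem_insert_self _ _) i (Finset.mem_inter.1 hi).1
    linarith

open Finset in
/-- If every weighting of the demands admits a solution of small weighted cost, then any family of
fewer than `2 ^ k` demands is served, up to a factor `2`, by `k` solutions. -/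
theorem exists_fin_family_of_forall_weights {𝒯 Q : Type*} [Fintype Q] (cost : 𝒯 → Q → ℝ)
    (W : Q → ℝ) {α : ℝ} (hα : 0 < α) (hcost : ∀ T p, 0 ≤ cost T p)
    (H : ∀ y : Q → ℝ, (∀ p, 0 ≤ y p) → ∃ T, ∑ p, y p * cost T p ≤ α * ∑ p, y p * W p) :
    ∀ (k : ℕ) (S : Finset Q), (∀ p ∈ S, 0 < W p) → #S < 2 ^ k →
      ∃ T : Fin k → 𝒯, ∀ p ∈ S, ∃ i, cost (T i) p ≤ 2 * α * W p := by
  classical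
  intro k
  induction k with
  | zero =>
    intro S _ hS
    rw [pow_zero, Nat.lt_one_iff, card_eq_zero] at hS
    exact ⟨Fin.elim0, by simp [hS]⟩
  | succ k ih =>
    intro S hW hS
    obtain ⟨T₀, hT₀⟩ := H (fun p => if p ∈ S then (W p)⁻¹ else 0) fun p => by
      split_ifs with h
      · exact (inv_pos.2 (hW p h)).le
      · exact le_rfl
    simp only [ite_mul, zero_mul, sum_ite_mem, univ_inter] at hT₀
    rw [sum_congr rfl fun p hp => inv_mul_cancel₀ (hW p hp).ne', sum_const, nsmul_eq_mul,
      mul_one] at hT₀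
    let B := S.filter fun p => 2 * α * W p < cost T₀ p
    have hB : (#B : ℝ) * (2 * α) ≤ α * #S := by
      refine le_trans ?_ ((sum_le_sum_of_subset_of_nonneg (show B ⊆ S from filter_subset _ S) fun p hp _ =>
        mul_nonneg (inv_pos.2 (hW p hp)).le (hcost T₀ p)).trans hT₀)
      rw [← nsmul_eq_mul]
      refine card_nsmul_le_sum _ _ _ fun p hp => ?_
      rw [mem_filter] at hp
      rw [← div_eq_inv_mul, le_div_iff₀ (hW p hp.1)]
      exact hp.2.le
    have hcard : 2 * #B ≤ #S := by
      have : (2 * #B : ℝ) ≤ #S := le_of_mul_le_mul_left (by linarith) hα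
      exact_mod_cast this
    obtain ⟨T, hT⟩ := ih B (fun p hp => hW p (mem_filter.1 hp).1) (by rw [pow_succ] at hS; omega)
    refine ⟨Fin.cons T₀ T, fun p hp => ?_⟩
    by_cases h : cost T₀ p ≤ 2 * α * W p
    · exact ⟨0, h⟩
    · obtain ⟨i, hi⟩ := hT p (mem_filter.2 ⟨hp, not_le.1 h⟩)
      exact ⟨i.succ, by simpa using hi⟩

theorem LevelTree.cost_nonneg {V : Type*} {d : V → V → ℝ} {r : V} {K : ℕ} (T : LevelTree d r K)
    (a b : V) : 0 ≤ T.cost a b := by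
  obtain ⟨A, -, hA, -⟩ := T.link a b
  exact (Finset.sum_nonneg fun _ _ => by positivity).trans hA

theorem card_pow_card_lt {n : ℕ} (hn : n ≠ 0) : n ^ n < 2 ^ (n * (Nat.log 2 n + 1)) := by
  rw [mul_comm, pow_mul]
  exact Nat.pow_lt_pow_left (Nat.lt_pow_succ_log_self one_lt_two n) hn

theorem mul_log_succ_le {n : ℕ} (hn : 2 ≤ n) :
    ((n * (Nat.log 2 n + 1) : ℕ) : ℝ) ≤ 4 * n * Real.log n := by
  have h2 := Real.log_two_gt_d9
  have hn' : (2 : ℝ) ≤ n := by exact_mod_cast hn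
  have h3 := Real.log_le_log two_pos hn'
  have h4 : (Nat.log 2 n : ℝ) * Real.log 2 ≤ Real.log n := by
    rw [← Real.log_pow]
    exact Real.log_le_log (by positivity) (by exact_mod_cast Nat.pow_log_le_self 2 (by omega))
  have h5 : (Nat.log 2 n : ℝ) * (1 / 2) ≤ Nat.log 2 n * Real.log 2 :=
    mul_le_mul_of_nonneg_left (by linarith) (by positivity)
  have h6 : (Nat.log 2 n : ℝ) + 1 ≤ 4 * Real.log n := by linarith
  push_cast
  nlinarith

open Finset in
/-- Finitely many level trees such that every map `p` is served well by one of them. -/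
theorem exists_levelTree_family {V : Type*} [Fintype V] {d : V → V → ℝ} (r : V)
    (d_self : ∀ a, d a a = 0) (d_symm : ∀ a b, d a b = d b a)
    (d_tri : ∀ a b x, d a x ≤ d a b + d b x) (d_one : ∀ a b, a ≠ b → 1 ≤ d a b)
    (hV : 2 ≤ Fintype.card V) :
    ∃ (K : ℕ) (T : Fin (Fintype.card V * (Nat.log 2 (Fintype.card V) + 1)) → LevelTree d r K),
      ∀ p : V → V, ∃ i, ∑ v, (T i).cost v (p v) ≤
        1792 * Real.log (Fintype.card V) * ∑ v, d v (p v) := by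
  classical
  have d0 : ∀ a b, 0 ≤ d a b := fun a b => by
    have := d_tri a b a
    rw [d_self, d_symm b a] at this
    linarith
  have hlog := half_le_log_card hV
  obtain ⟨K, hK1, hK⟩ : ∃ K : ℕ, 1 ≤ K ∧ ∀ a b, d a b ≤ 2 ^ K := by
    obtain ⟨K, hK⟩ := pow_unbounded_of_one_lt (∑ q : V × V, d q.1 q.2) (one_lt_two (α := ℝ))
    refine ⟨K + 1, by omega, fun a b => ?_⟩
    have := single_le_sum (f := fun q : V × V => d q.1 q.2) (fun q _ => d0 q.1 q.2)
      (mem_univ (a, b))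
    exact (this.trans hK.le).trans (pow_le_pow_right₀ one_le_two (by omega))
  obtain ⟨T, hT⟩ := exists_fin_family_of_forall_weights (Q := V → V)
    (fun (T : LevelTree d r K) p => ∑ v, T.cost v (p v)) (fun p => ∑ v, d v (p v))
    (α := 896 * Real.log (Fintype.card V)) (by linarith)
    (fun T p => sum_nonneg fun v _ => T.cost_nonneg _ _) (fun y hy => by
      let c : V × V → ℝ := fun q => ∑ p : V → V, if p q.1 = q.2 then y p else 0
      obtain ⟨T, hT⟩ := exists_levelTree r d_self d_symm d_tri d_one hV hK1 hK c
        fun q => sum_nonneg fun p _ => by split_ifs <;> simp [hy]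
      have key : ∀ f : V → V → ℝ, ∑ q : V × V, c q * f q.1 q.2 =
          ∑ p : V → V, y p * ∑ v, f v (p v) := by
        intro f
        have hrow : ∀ a, ∑ b, c (a, b) * f a b = ∑ p : V → V, y p * f a (p a) := by
          intro a
          simp only [c, sum_mul, ite_mul, zero_mul]
          rw [sum_comm]
          simp
        simp_rw [mul_sum]
        rw [Fintype.sum_prod_type, sum_congr rfl fun a _ => hrow a, sum_comm]
      exact ⟨T, by rwa [key, key] at hT⟩)
    (Fintype.card V * (Nat.log 2 (Fintype.card V) + 1)) (univ.filter fun p => 0 < ∑ v, d v (p v))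
    (fun p hp => (mem_filter.1 hp).2)
    ((card_le_univ _).trans_lt (by rw [Fintype.card_fun]; exact card_pow_card_lt (by omega)))
  refine ⟨K, T, fun p => ?_⟩
  rcases (sum_nonneg fun v _ => d0 v (p v) : 0 ≤ ∑ v, d v (p v)).lt_or_eq with h | h
  · obtain ⟨i, hi⟩ := hT p (by simpa using h)
    exact ⟨i, hi.trans (le_of_eq (by ring))⟩
  · have hp : ∀ v, p v = v := fun v => by
      have := (sum_eq_zero_iff_of_nonneg fun v _ => d0 v (p v)).1 h.symm v (mem_univ v)
      by_contra hne
      linarith [d_one v (p v) (Ne.symm hne)]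
    refine ⟨⟨0, by positivity⟩, ?_⟩
    simp [hp, d_self, LevelTree.cost_self]

section ParentGraph

variable {X : Type*} {root : X} {par : X → X} {lev : X → ℕ}

/-- The graph joining every `x ≠ root` to its parent. -/
def parentGraph (root : X) (par : X → X) : SimpleGraph X :=
  SimpleGraph.fromEdgeSet ((fun x => s(x, par x)) '' {root}ᶜ)

theorem edgeSet_parentGraph (hlev : ∀ x ≠ root, lev x < lev (par x)) :
    (parentGraph root par).edgeSet = (fun x => s(x, par x)) '' {root}ᶜ := by
  rw [parentGraph, SimpleGraph.edgeSet_fromEdgeSet, sdiff_eq_left, Set.disjoint_left]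
  rintro _ ⟨x, hx, rfl⟩ hdiag
  have hxx : x = par x := by simpa using hdiag
  have := hlev x hx
  rw [← hxx] at this
  exact lt_irrefl _ this

theorem parentGraph_adj_iff (hlev : ∀ x ≠ root, lev x < lev (par x)) {x y : X} :
    (parentGraph root par).Adj x y ↔ (x ≠ root ∧ par x = y) ∨ (y ≠ root ∧ par y = x) := by
  rw [← SimpleGraph.mem_edgeSet, edgeSet_parentGraph hlev]
  constructor
  · rintro ⟨z, hz, h⟩
    rcases Sym2.eq_iff.1 h with ⟨rfl, h'⟩ | ⟨rfl, h'⟩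
    · exact .inl ⟨hz, h'⟩
    · exact .inr ⟨hz, h'⟩
  · rintro (⟨h, rfl⟩ | ⟨h, rfl⟩)
    · exact ⟨x, h, rfl⟩
    · exact ⟨y, h, Sym2.eq_swap⟩

theorem injOn_parentEdge (hlev : ∀ x ≠ root, lev x < lev (par x)) :
    Set.InjOn (fun x => s(x, par x)) {root}ᶜ := by
  intro x hx y hy h
  rcases Sym2.eq_iff.1 h with ⟨h, -⟩ | ⟨h1, h2⟩
  · exact h
  · have h3 := hlev x hx
    have h4 := hlev y hy
    rw [h2] at h3
    rw [← h1] at h4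
    exact absurd h3 (not_lt.2 h4.le)

theorem exists_depth {B : ℕ} (hB : ∀ x, lev x ≤ B) (hlev : ∀ x ≠ root, lev x < lev (par x)) :
    ∃ D : X → ℕ, D root = 0 ∧ ∀ x ≠ root, D x = D (par x) + 1 := by
  have hP : ∃ par' : X → X, par' root = root ∧ ∀ x ≠ root, par' x = par x := by
    classical
    exact ⟨fun x => if x = root then root else par x, by simp, fun x hx => by simp [hx]⟩
  obtain ⟨par', h1, h2⟩ := hP
  have hex : ∀ x, ∃ k, par'^[k] x = root := by
    intro x
    induction hn : B - lev x using Nat.strong_induction_on generalizing x with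
    | _ n ih =>
      by_cases hx : x = root
      · exact ⟨0, hx⟩
      · have h3 := hlev x hx
        have h4 := hB (par x)
        obtain ⟨k, hk⟩ := ih (B - lev (par x)) (by omega) (par x) rfl
        exact ⟨k + 1, by rw [Function.iterate_succ_apply, h2 x hx, hk]⟩
  classical
  refine ⟨fun x => Nat.find (hex x), by simp, fun x hx => ?_⟩
  refine (Nat.find_comp_succ (hex x) ?_ hx).trans ?_
  · simpa [h2 x hx] using hex (par x)
  · simp only [Function.iterate_succ_apply, h2 x hx]

theorem parentGraph_connected {B : ℕ} (hB : ∀ x, lev x ≤ B)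
    (hlev : ∀ x ≠ root, lev x < lev (par x)) : (parentGraph root par).Connected := by
  rw [SimpleGraph.connected_iff_exists_forall_reachable]
  refine ⟨root, fun x => ?_⟩
  obtain ⟨D, -, hD⟩ := exists_depth hB hlev
  induction hn : D x generalizing x with
  | zero =>
    by_cases hx : x = root
    · rw [hx]
    · have := hD x hx
      omega
  | succ n ih =>
    by_cases hx : x = root
    · rw [hx]
    · have := hD x hx
      exact (ih (par x) (by omega)).trans
        ((parentGraph_adj_iff hlev).2 (.inr ⟨hx, rfl⟩)).reachable

theorem parentGraph_isTree [Finite X] {B : ℕ} (hB : ∀ x, lev x ≤ B)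
    (hlev : ∀ x ≠ root, lev x < lev (par x)) : (parentGraph root par).IsTree := by
  rw [SimpleGraph.isTree_iff_connected_and_card]
  refine ⟨parentGraph_connected hB hlev, ?_⟩
  rw [edgeSet_parentGraph hlev, Nat.card_coe_set_eq, (injOn_parentEdge hlev).ncard_image,
    ← Set.ncard_add_ncard_compl {root}, Set.ncard_singleton, add_comm]

theorem dist_root_parentGraph {B : ℕ} (hB : ∀ x, lev x ≤ B)
    (hlev : ∀ x ≠ root, lev x < lev (par x)) {x : X} (hx : x ≠ root) :
    (parentGraph root par).dist root x = (parentGraph root par).dist root (par x) + 1 := by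
  obtain ⟨D, hD0, hD⟩ := exists_depth hB hlev
  have hconn := parentGraph_connected hB hlev
  have hwalk : ∀ {u v : X} (p : (parentGraph root par).Walk u v), D v ≤ D u + p.length := by
    intro u v p
    induction p with
    | nil => simp
    | cons h p ih =>
      rw [SimpleGraph.Walk.length_cons]
      rcases (parentGraph_adj_iff hlev).1 h with ⟨h1, rfl⟩ | ⟨h1, rfl⟩
      · have := hD _ h1
        omega
      · have := hD _ h1
        omega
  have hdist : ∀ x, (parentGraph root par).dist root x = D x := by
    intro x
    refine le_antisymm ?_ ?_
    · induction hn : D x generalizing x with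
      | zero =>
        by_cases hx : x = root
        · simp [hx]
        · have := hD x hx
          omega
      | succ n ih =>
        by_cases hx : x = root
        · simp [hx]
        · have h1 := hD x hx
          have h2 := ih (par x) (by omega)
          have h3 := SimpleGraph.dist_eq_one_iff_adj.2
            ((parentGraph_adj_iff hlev).2 (.inr ⟨hx, rfl⟩) : (parentGraph root par).Adj (par x) x)
          have h4 := hconn.dist_triangle (u := root) (v := par x) (w := x)
          omega
    · obtain ⟨p, hp⟩ := (hconn root x).exists_walk_length_eq_dist
      have := hwalk p
      omega
  rw [hdist, hdist, hD x hx]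

/-- The weight of the tree edge above `x` is `2 ^ lev x`. -/
noncomputable def levelWeight (lev : X → ℕ) : Sym2 X → ℝ :=
  Sym2.lift ⟨fun x y => min ((2 : ℝ) ^ lev x) (2 ^ lev y), fun _ _ => min_comm _ _⟩

theorem levelWeight_par (hlev : ∀ x ≠ root, lev x < lev (par x)) {x : X} (hx : x ≠ root) :
    levelWeight lev s(x, par x) = 2 ^ lev x :=
  min_eq_left (pow_le_pow_right₀ one_le_two (hlev x hx).le)

theorem parentGraph_wellSeparated {B : ℕ} (hB : ∀ x, lev x ≤ B)
    (hlev : ∀ x ≠ root, lev x < lev (par x)) :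
    WellSeparated (parentGraph root par) root (levelWeight lev) := by
  have hup : ∀ a b, (parentGraph root par).Adj a b → (parentGraph root par).dist root b =
      (parentGraph root par).dist root a + 1 → b ≠ root ∧ par b = a := by
    intro a b hab hd
    rcases (parentGraph_adj_iff hlev).1 hab with ⟨h, rfl⟩ | h
    · have := dist_root_parentGraph hB hlev h
      omega
    · exact h
  intro a b c hab hbc hb hc
  obtain ⟨hb', rfl⟩ := hup a b hab hb
  obtain ⟨hc', rfl⟩ := hup b c hbc hc
  rw [Sym2.eq_swap, levelWeight_par hlev hc', Sym2.eq_swap, levelWeight_par hlev hb',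
    le_div_iff₀ two_pos, ← pow_succ]
  exact pow_le_pow_right₀ one_le_two (hlev c hc')

end ParentGraph

/-- Every pair of vertices has a cheapest edge set connecting it. -/
theorem exists_cheapest_connecting {V : Type*} [Finite V] {G : SimpleGraph V} (hG : G.Connected)
    (w : Sym2 V → ℝ) :
    ∃ P : V → V → Finset (Sym2 V), ∀ a b, ↑(P a b) ⊆ G.edgeSet ∧ EdgeConn ↑(P a b) a b ∧
      ∀ F : Finset (Sym2 V), ↑F ⊆ G.edgeSet → EdgeConn ↑F a b →
        ∑ e ∈ P a b, w e ≤ ∑ e ∈ F, w e := by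
  classical
  have := Fintype.ofFinite V
  have h : ∀ a b : V, ∃ P : Finset (Sym2 V), ↑P ⊆ G.edgeSet ∧ EdgeConn ↑P a b ∧
      ∀ F : Finset (Sym2 V), ↑F ⊆ G.edgeSet → EdgeConn ↑F a b →
        ∑ e ∈ P, w e ≤ ∑ e ∈ F, w e := by
    intro a b
    obtain ⟨P, hP, hmin⟩ := Finset.exists_min_image
      {F : Finset (Sym2 V) |
        (F : Set (Sym2 V)) ⊆ G.edgeSet ∧ EdgeConn (F : Set (Sym2 V)) a b}
      (fun F => ∑ e ∈ F, w e) ⟨G.edgeFinset, by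
        rw [Finset.mem_filter, SimpleGraph.coe_edgeFinset, EdgeConn,
          SimpleGraph.fromEdgeSet_edgeSet]
        exact ⟨Finset.mem_univ _, subset_rfl, hG a b⟩⟩
    simp only [Finset.mem_filter, Finset.mem_univ, true_and] at hP hmin
    exact ⟨P, hP.1, hP.2, fun F h1 h2 => hmin F ⟨h1, h2⟩⟩
  choose P hP using h
  exact ⟨P, hP⟩

/-- An edge set contains a spanning forest, described by a parent map decreasing a height. -/
theorem exists_forest_parents {V : Type*} (F : Set (Sym2 V)) :
    ∃ (p : V → V) (h : V → ℕ), (∀ v, p v ≠ v → s(v, p v) ∈ F ∧ h (p v) < h v) ∧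
      ∀ u v, EdgeConn F u v → EdgeConn ((fun v => s(v, p v)) '' {v | p v ≠ v}) u v := by
  let H := SimpleGraph.fromEdgeSet F
  let rep : V → V := fun v => (H.connectedComponentMk v).out
  have hrep : ∀ v, H.Reachable v (rep v) := fun v =>
    (SimpleGraph.ConnectedComponent.eq.1 (Quot.out_eq (H.connectedComponentMk v))).symm
  have hcongr : ∀ u v, H.Reachable u v → rep u = rep v := fun u v h => by
    simp only [rep, SimpleGraph.ConnectedComponent.eq.2 h]
  let h : V → ℕ := fun v => H.dist v (rep v)
  have hstep : ∀ v, ∃ y, (v = rep v ∧ y = v) ∨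
      (v ≠ rep v ∧ H.Adj v y ∧ h y < h v) := by
    intro v
    by_cases hv : v = rep v
    · exact ⟨v, .inl ⟨hv, rfl⟩⟩
    · obtain ⟨q, hq⟩ := (hrep v).exists_walk_length_eq_dist
      generalize hx : rep v = x at q hq hv
      cases q with
      | nil => exact absurd rfl hv
      | @cons _ y _ hadj q =>
        refine ⟨y, .inr ⟨hv, hadj, ?_⟩⟩
        have h1 : h y ≤ q.length := by
          simp only [h]
          rw [← hcongr v y hadj.reachable, hx]
          exact SimpleGraph.dist_le q
        have h2 : h v = H.dist v x := by simp only [h, hx]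
        rw [SimpleGraph.Walk.length_cons] at hq
        omega
  choose p hp using hstep
  have hstep' : ∀ v, v ≠ rep v → H.Adj v (p v) ∧ h (p v) < h v := fun v hv => by
    rcases hp v with h1 | h1
    · exact absurd h1.1 hv
    · exact h1.2
  refine ⟨p, h, fun v hv => ?_, ?_⟩
  · obtain ⟨h1, h2⟩ := hstep' v fun h => by
      rcases hp v with h1 | h1
      · exact hv h1.2
      · exact h1.1 h
    exact ⟨((SimpleGraph.fromEdgeSet_adj F).1 h1).1, h2⟩
  have hto : ∀ v, EdgeConn ((fun v => s(v, p v)) '' {v | p v ≠ v}) v (rep v) := by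
    intro v
    induction hn : h v using Nat.strong_induction_on generalizing v with
    | _ n ih =>
      by_cases hv : v = rep v
      · rw [← hv]
        exact EdgeConn.refl _ _
      · obtain ⟨h1, h2⟩ := hstep' v hv
        have h3 := ih _ (hn ▸ h2) (p v) rfl
        rw [← hcongr v (p v) h1.reachable] at h3
        have h4 : s(v, p v) ∈ (fun v => s(v, p v)) '' {v | p v ≠ v} := ⟨v, h1.ne', rfl⟩
        exact (EdgeConn.of_mem h4).trans h3
  intro u v huv
  have := hto v
  rw [← hcongr u v huv] at this
  exact (hto u).trans this.symm

/-- The cost of a cheapest connecting edge set is a metric bounded by the edge weights. -/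
theorem exists_connecting_metric {V : Type*} [Finite V] {G : SimpleGraph V} (hG : G.Connected)
    {w : Sym2 V → ℝ} (hw : ∀ e ∈ G.edgeSet, 1 ≤ w e) :
    ∃ P : V → V → Finset (Sym2 V), (∀ a b, ↑(P a b) ⊆ G.edgeSet) ∧
      (∀ a b, EdgeConn ↑(P a b) a b) ∧ (∀ a, ∑ e ∈ P a a, w e = 0) ∧
      (∀ a b, ∑ e ∈ P a b, w e = ∑ e ∈ P b a, w e) ∧
      (∀ a b x, ∑ e ∈ P a x, w e ≤ ∑ e ∈ P a b, w e + ∑ e ∈ P b x, w e) ∧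
      (∀ a b, a ≠ b → 1 ≤ ∑ e ∈ P a b, w e) ∧
      ∀ a b, s(a, b) ∈ G.edgeSet → ∑ e ∈ P a b, w e ≤ w s(a, b) := by
  classical
  obtain ⟨P, hP⟩ := exists_cheapest_connecting hG w
  have hsub := fun a b => (hP a b).1
  have hconn := fun a b => (hP a b).2.1
  have hmin := fun a b => (hP a b).2.2
  have hpos : ∀ a b, ∀ e ∈ P a b, 0 ≤ w e := fun a b e he =>
    zero_le_one.trans (hw e (hsub a b he))
  have hle : ∀ a b, ∑ e ∈ P a b, w e ≤ ∑ e ∈ P b a, w e := fun a b =>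
    hmin a b _ (hsub b a) (hconn b a).symm
  refine ⟨P, hsub, hconn, fun a => ?_, fun a b => (hle a b).antisymm (hle b a),
    fun a b x => ?_, fun a b hab => ?_, fun a b hab => ?_⟩
  · refine le_antisymm ?_ (Finset.sum_nonneg (hpos a a))
    simpa using hmin a a ∅ (by simp) (EdgeConn.refl _ a)
  · refine (hmin a x (P a b ∪ P b x) ?_ ?_).trans ?_
    · rw [Finset.coe_union]
      exact Set.union_subset (hsub a b) (hsub b x)
    · rw [Finset.coe_union]
      exact ((hconn a b).mono Set.subset_union_left).trans
        ((hconn b x).mono Set.subset_union_right)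
    · have h1 := Finset.sum_union_inter (s₁ := P a b) (s₂ := P b x) (f := w)
      have h2 : 0 ≤ ∑ e ∈ P a b ∩ P b x, w e :=
        Finset.sum_nonneg fun e he => hpos a b e (Finset.mem_of_mem_inter_left he)
      linarith
  · obtain ⟨e, he⟩ : (P a b).Nonempty := by
      rw [Finset.nonempty_iff_ne_empty]
      intro h
      have := hconn a b
      rw [h, Finset.coe_empty, EdgeConn, SimpleGraph.fromEdgeSet_empty,
        SimpleGraph.reachable_bot] at this
      exact hab this
    exact (hw e (hsub a b he)).trans (Finset.single_le_sum (hpos a b) he)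
  · simpa using hmin a b {s(a, b)} (by simpa using hab)
      (EdgeConn.of_mem (by simp))

section Merge

variable {V : Type*} {d : V → V → ℝ} {r : V} {K k : ℕ}

/-- Vertices of `k` trees on the same vertex set, glued at their common root `r`. -/
abbrev GluedVertex (k : ℕ) (r : V) : Type _ := Option (Fin k × {v // v ≠ r})

open Classical in
/-- The copy of `v` in the `i`-th tree. -/
noncomputable def gluedCopy (r : V) (i : Fin k) (v : V) : GluedVertex k r :=
  if h : v = r then none else some (i, ⟨v, h⟩)

def gluedBase : GluedVertex k r → V
  | none => r
  | some x => x.2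

noncomputable def gluedPar (T : Fin k → LevelTree d r K) : GluedVertex k r → GluedVertex k r
  | none => none
  | some x => gluedCopy r x.1 ((T x.1).par x.2)

def gluedLev (T : Fin k → LevelTree d r K) : GluedVertex k r → ℕ
  | none => K + 1
  | some x => (T x.1).lev x.2

theorem gluedCopy_of_ne (i : Fin k) {v : V} (hv : v ≠ r) :
    gluedCopy r i v = some (i, ⟨v, hv⟩) :=
  dif_neg hv

theorem gluedCopy_root (i : Fin k) : gluedCopy r i r = none :=
  dif_pos rfl

theorem gluedBase_gluedCopy (i : Fin k) (v : V) : gluedBase (gluedCopy r i v) = v := by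
  by_cases hv : v = r
  · subst hv
    rw [gluedCopy_root, gluedBase]
  · rw [gluedCopy_of_ne i hv, gluedBase]

theorem gluedPar_gluedCopy (T : Fin k → LevelTree d r K) (i : Fin k) {v : V} (hv : v ≠ r) :
    gluedPar T (gluedCopy r i v) = gluedCopy r i ((T i).par v) := by
  rw [gluedCopy_of_ne i hv, gluedPar]

theorem gluedLev_gluedCopy (T : Fin k → LevelTree d r K) (i : Fin k) (v : V) :
    gluedLev T (gluedCopy r i v) = (T i).lev v := by
  by_cases hv : v = r
  · subst hv
    rw [gluedCopy_root, gluedLev, (T i).lev_root]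
  · rw [gluedCopy_of_ne i hv, gluedLev]

theorem gluedLev_le (T : Fin k → LevelTree d r K) (x : GluedVertex k r) :
    gluedLev T x ≤ K + 1 := by
  cases x with
  | none => exact le_rfl
  | some x => exact (T x.1).lev_le x.2

theorem gluedLev_lt (T : Fin k → LevelTree d r K) (x : GluedVertex k r) (hx : x ≠ none) :
    gluedLev T x < gluedLev T (gluedPar T x) := by
  cases x with
  | none => exact absurd rfl hx
  | some x =>
    rw [gluedPar, gluedLev_gluedCopy, gluedLev]
    exact (T x.1).lev_lt x.2 x.2.2

theorem dist_gluedBase_le (T : Fin k → LevelTree d r K) {x : GluedVertex k r} (hx : x ≠ none) :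
    d (gluedBase x) (gluedBase (gluedPar T x)) ≤ 2 ^ gluedLev T x := by
  cases x with
  | none => exact absurd rfl hx
  | some x =>
    rw [gluedPar, gluedBase_gluedCopy, gluedBase, gluedLev]
    exact (T x.1).dist_le x.2 x.2.2

theorem ncard_preimage_gluedBase_le [Finite V] (hk : 0 < k) (v : V) :
    (gluedBase (k := k) (r := r) ⁻¹' {v}).ncard ≤ k := by
  have hsub : gluedBase (k := k) (r := r) ⁻¹' {v} ⊆ Set.range fun i => gluedCopy r i v := by
    rintro x rfl
    cases x with
    | none => exact ⟨⟨0, hk⟩, gluedCopy_root _⟩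
    | some x => exact ⟨x.1, gluedCopy_of_ne _ x.2.2⟩
  refine (Set.ncard_le_ncard hsub (Set.toFinite _)).trans ?_
  rw [← Set.image_univ]
  refine (Set.ncard_image_le (Set.toFinite _)).trans ?_
  rw [Set.ncard_univ, Nat.card_eq_fintype_card, Fintype.card_fin]

/-- Edge sets of the graph map to cheap edge sets of a single glued tree. -/
theorem exists_glued_edges [Fintype V] (T : Fin k → LevelTree d r K) {c : ℝ} (hc : 0 ≤ c)
    (hT : ∀ p : V → V, ∃ i, ∑ v, (T i).cost v (p v) ≤ c * ∑ v, d v (p v))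
    (d_self : ∀ a, d a a = 0) {w : Sym2 V → ℝ} {F : Finset (Sym2 V)}
    (hw : ∀ e ∈ F, 0 ≤ w e) (hd : ∀ a b, s(a, b) ∈ F → d a b ≤ w s(a, b)) :
    ∃ M : Finset (Sym2 (GluedVertex k r)),
      ↑M ⊆ (parentGraph none (gluedPar T)).edgeSet ∧
      (∀ u v, EdgeConn ↑F u v →
        SetConn (M : Set (Sym2 (GluedVertex k r))) (gluedBase ⁻¹' {u}) (gluedBase ⁻¹' {v})) ∧
      ∑ e ∈ M, levelWeight (gluedLev T) e ≤ c * ∑ e ∈ F, w e := by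
  classical
  obtain ⟨p, h, hp, hconn⟩ := exists_forest_parents (V := V) (F : Set (Sym2 V))
  obtain ⟨i, hi⟩ := hT p
  choose A hAr hAcost hAconn using fun v => (T i).link v (p v)
  have hne : ∀ v, ∀ x ∈ A v, x ≠ r := fun v x hx hxr => hAr v (hxr ▸ hx)
  have hcopy : ∀ x, x ≠ r → gluedCopy r i x ≠ none := fun x hx => by
    rw [gluedCopy_of_ne i hx]
    exact Option.some_ne_none _
  let edge : V → Sym2 (GluedVertex k r) := fun x => s(gluedCopy r i x, gluedPar T (gluedCopy r i x))
  have hedge : ∀ x, x ≠ r → levelWeight (gluedLev T) (edge x) = 2 ^ (T i).lev x := fun x hx => by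
    rw [← gluedLev_gluedCopy T i x]
    exact levelWeight_par (gluedLev_lt T) (hcopy x hx)
  refine ⟨Finset.univ.biUnion fun v => (A v).image edge, ?_, fun u v huv => ?_, ?_⟩
  · rw [edgeSet_parentGraph (gluedLev_lt T)]
    intro e he
    obtain ⟨v, -, he⟩ := Finset.mem_biUnion.1 (Finset.mem_coe.1 he)
    obtain ⟨x, hx, rfl⟩ := Finset.mem_image.1 he
    exact ⟨gluedCopy r i x, hcopy x (hne v x hx), rfl⟩
  · refine ⟨gluedCopy r i u, gluedBase_gluedCopy i u, gluedCopy r i v,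
      gluedBase_gluedCopy i v, ?_⟩
    refine (hconn u v huv).induction _ ?_
    rintro a b ⟨x, -, hx⟩
    have hlink : EdgeConn (↑(Finset.univ.biUnion fun v => (A v).image edge) :
        Set (Sym2 (GluedVertex k r))) (gluedCopy r i x) (gluedCopy r i (p x)) := by
      refine (hAconn x).induction _ ?_
      rintro a b ⟨y, hy, hab⟩
      refine EdgeConn.of_mem (Finset.mem_coe.2 (Finset.mem_biUnion.2
        ⟨x, Finset.mem_univ x, Finset.mem_image.2 ⟨y, hy, ?_⟩⟩))
      simp only [edge]
      rw [gluedPar_gluedCopy T i (hne x y hy)]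
      exact congrArg (Sym2.map (gluedCopy r i)) hab
    rcases Sym2.eq_iff.1 hx with ⟨rfl, rfl⟩ | ⟨rfl, rfl⟩
    · exact hlink
    · exact hlink.symm
  · have hnonneg : ∀ v, ∀ e ∈ (A v).image edge, 0 ≤ levelWeight (gluedLev T) e := by
      intro v e he
      obtain ⟨x, hx, rfl⟩ := Finset.mem_image.1 he
      rw [hedge x (hne v x hx)]
      positivity
    have himage : ∀ v, ∑ e ∈ (A v).image edge, levelWeight (gluedLev T) e ≤
        (T i).cost v (p v) := by
      intro v
      refine le_trans ?_ (hAcost v)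
      rw [← Finset.biUnion_singleton]
      refine (Finset.sum_biUnion_le_of_nonneg _ _ _ ?_).trans (Finset.sum_le_sum ?_)
      · intro x hx e he
        rw [Finset.mem_singleton.1 he, hedge x (hne v x hx)]
        positivity
      · intro x hx
        rw [Finset.sum_singleton, hedge x (hne v x hx)]
    refine (Finset.sum_biUnion_le_of_nonneg _ _ _ fun v _ => hnonneg v).trans
      ((Finset.sum_le_sum fun v _ => himage v).trans (hi.trans ?_))
    refine mul_le_mul_of_nonneg_left ?_ hc
    have hinj : Set.InjOn (fun v => s(v, p v)) {v | p v ≠ v} := by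
      intro u hu v hv huv
      rcases Sym2.eq_iff.1 huv with ⟨h1, -⟩ | ⟨h1, h2⟩
      · exact h1
      · have h3 := (hp u hu).2
        have h4 := (hp v hv).2
        rw [h2] at h3
        rw [← h1] at h4
        exact absurd h3 h4.not_gt
    calc ∑ v, d v (p v) = ∑ v with p v ≠ v, d v (p v) := by
          refine (Finset.sum_filter_of_ne (p := fun v => p v ≠ v) fun v _ hv hpv => hv ?_).symm
          rw [hpv, d_self]
      _ ≤ ∑ v with p v ≠ v, w s(v, p v) :=
          Finset.sum_le_sum fun v hv => hd _ _ (hp v (Finset.mem_filter.1 hv).2).1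
      _ = ∑ e ∈ {v | p v ≠ v}.toFinset.image (fun v => s(v, p v)), w e := by
          rw [Finset.sum_image (by simpa using hinj)]
          exact Finset.sum_congr (by ext; simp) fun _ _ => rfl
      _ ≤ ∑ e ∈ F, w e := by
          refine Finset.sum_le_sum_of_subset_of_nonneg ?_ fun e he _ => hw e he
          intro e he
          obtain ⟨v, hv, rfl⟩ := Finset.mem_image.1 he
          exact (hp v (by simpa using hv)).1

end Merge

/-- There is a universal constant `C` such that every weighted graph on
`n ≥ 2` vertices with edge weights at least `1`, with any root `r`, admits a well-separated
`(C·log n)`-approximate copy tree embedding with copy number at most `C·n·log n`. -/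
theorem exists_copyTreeEmbedding_log_approx_nlog_copies :
    ∃ C : ℝ, 0 < C ∧
      ∀ (V : Type) [Fintype V], ∀ (G : SimpleGraph V) (w : Sym2 V → ℝ) (r : V),
        2 ≤ Fintype.card V → G.Connected → (∀ e ∈ G.edgeSet, 1 ≤ w e) →
        ∃ (V' : Type) (_ : Finite V')
          (emb : CopyTreeEmbedding V V' G w r
            (C * Real.log (Fintype.card V : ℝ))),
          WellSeparated emb.tree emb.root emb.w' ∧
          ∀ v : V, ((emb.copies v).ncard : ℝ) ≤
            C * (Fintype.card V : ℝ) * Real.log (Fintype.card V : ℝ) := by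
  classical
  refine ⟨1792, by norm_num, ?_⟩
  intro V _ G w r hV hG hw
  obtain ⟨P, hsub, hconn, d_self, d_symm, d_tri, d_one, d_edge⟩ := exists_connecting_metric hG hw
  obtain ⟨K, T, hT⟩ := exists_levelTree_family r d_self d_symm d_tri d_one hV
  have hc : 0 ≤ 1792 * Real.log (Fintype.card V) := by positivity
  let k := Fintype.card V * (Nat.log 2 (Fintype.card V) + 1)
  have hGT : ∀ F : Finset (Sym2 V), ∃ M : Finset (Sym2 (GluedVertex k r)), ↑F ⊆ G.edgeSet →
      ↑M ⊆ (parentGraph none (gluedPar T)).edgeSet ∧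
      (∀ u v : V, EdgeConn ↑F u v → SetConn (M : Set (Sym2 (GluedVertex k r))) (gluedBase ⁻¹' {u})
        (gluedBase ⁻¹' {v})) ∧
      ∑ e ∈ M, levelWeight (gluedLev T) e ≤
        1792 * Real.log (Fintype.card V) * ∑ e ∈ F, w e := by
    intro F
    by_cases hF : ↑F ⊆ G.edgeSet
    · obtain ⟨M, hM⟩ := exists_glued_edges T hc hT d_self (w := w) (F := F)
        (fun e he => zero_le_one.trans (hw e (hF he))) fun a b hab => d_edge a b (hF hab)
      exact ⟨M, fun _ => hM⟩
    · exact ⟨∅, fun h => absurd h hF⟩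
  choose mapGT hmapGT using hGT
  have hTG : ∀ e : Sym2 (GluedVertex k r), ∃ Q : Finset (Sym2 V),
      e ∈ (parentGraph none (gluedPar T)).edgeSet → ↑Q ⊆ G.edgeSet ∧
        ∑ e ∈ Q, w e ≤ levelWeight (gluedLev T) e ∧
        ∀ x y, e = s(x, y) → EdgeConn ↑Q (gluedBase x) (gluedBase y) := by
    intro e
    by_cases he : e ∈ (parentGraph none (gluedPar T)).edgeSet
    · rw [edgeSet_parentGraph (gluedLev_lt T)] at he
      obtain ⟨x, hx, rfl⟩ := he
      refine ⟨P (gluedBase x) (gluedBase (gluedPar T x)), fun _ => ⟨hsub _ _, ?_, ?_⟩⟩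
      · rw [levelWeight_par (gluedLev_lt T) hx]
        exact dist_gluedBase_le T hx
      · intro y z hyz
        rcases Sym2.eq_iff.1 hyz with ⟨rfl, rfl⟩ | ⟨rfl, rfl⟩
        · exact hconn _ _
        · exact (hconn _ _).symm
    · exact ⟨∅, fun h => absurd h he⟩
  choose Q hQ using hTG
  let emb : CopyTreeEmbedding V (GluedVertex k r) G w r (1792 * Real.log (Fintype.card V)) :=
    { tree := parentGraph none (gluedPar T)
      isTree := parentGraph_isTree (gluedLev_le T) (gluedLev_lt T)
      w' := levelWeight (gluedLev T)
      root := none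
      copies := fun v => gluedBase ⁻¹' {v}
      copies_nonempty := fun v =>
        ⟨gluedCopy r ⟨0, Nat.mul_pos (by omega) (Nat.succ_pos _)⟩ v, gluedBase_gluedCopy _ v⟩
      copies_disjoint := fun u v huv =>
        Disjoint.preimage _ (Set.disjoint_singleton.2 huv)
      copies_cover := fun x => ⟨gluedBase x, rfl⟩
      copies_root := by
        ext x
        cases x with
        | none => exact iff_of_true rfl rfl
        | some x => exact iff_of_false x.2.2 (Option.some_ne_none x)
      mapGT := mapGT
      mapTG := fun F' => F'.biUnion Q
      mapGT_sub := fun F hF => (hmapGT F hF).1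
      mapTG_sub := fun F' hF' e he => by
        obtain ⟨f, hf, he⟩ := Finset.mem_biUnion.1 (Finset.mem_coe.1 he)
        exact (hQ f (hF' hf)).1 he
      mapTG_mono := fun A B hAB => Finset.biUnion_subset_biUnion_of_subset_left Q hAB
      conn_GT := fun F hF => (hmapGT F hF).2.1
      conn_TG := by
        rintro F' hF' _ _ u' v' rfl rfl huv
        refine huv.induction _ fun a b hab => ?_
        exact ((hQ _ (hF' hab)).2.2 a b rfl).mono
          (Finset.coe_subset.2 (Finset.subset_biUnion_of_mem Q hab))
      cost_GT := fun F hF => (hmapGT F hF).2.2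
      cost_TG := fun F' hF' => by
        refine (Finset.sum_biUnion_le_of_nonneg _ _ _ fun f hf e he => ?_).trans
          (Finset.sum_le_sum fun f hf => (hQ f (hF' hf)).2.1)
        exact zero_le_one.trans (hw e ((hQ f (hF' hf)).1 he)) }
  refine ⟨_, inferInstance, emb, parentGraph_wellSeparated (gluedLev_le T) (gluedLev_lt T),
    fun v => ?_⟩
  have h1 := ncard_preimage_gluedBase_le (r := r)
    (Nat.mul_pos (show 0 < Fintype.card V by omega) (Nat.succ_pos (Nat.log 2 (Fintype.card V)))) v
  have h2 := mul_log_succ_le hV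
  have h3 : 0 ≤ (Fintype.card V : ℝ) * Real.log (Fintype.card V) := by positivity
  have h4 : ((emb.copies v).ncard : ℝ) ≤
      ((Fintype.card V * (Nat.log 2 (Fintype.card V) + 1) : ℕ) : ℝ) := Nat.cast_le.2 h1
  linarith
end

section
/- Let G=(V,E,w) be a weighted graph with root r ∈ V and let (T,φ,π_{G→T},π_{T→G}) be an α-approximate copy tree embedding of (G,r). If there exists a β-competitive online group Steiner forest algorithm on the tree T, then there exists an (α·β)-competitive online group Steiner forest algorithm on G. -/
/-- A feasible group Steiner forest solution: an edge set of `G` connecting, for each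
pair `(Aᵢ, Bᵢ)`, some vertex of `Aᵢ` to some vertex of `Bᵢ`. -/
def GSFFeasible {V : Type*} (G : SimpleGraph V) (prs : List (Set V × Set V))
    (H : Finset (Sym2 V)) : Prop :=
  ↑H ⊆ G.edgeSet ∧ ∀ pr ∈ prs, SetConn (↑H) pr.1 pr.2

/-- A group Steiner forest request sequence is valid when both sides of every pair are
nonempty (so that the instance is satisfiable). -/
def GSFValid {V : Type*} (prs : List (Set V × Set V)) : Prop :=
  ∀ pr ∈ prs, pr.1.Nonempty ∧ pr.2.Nonempty

/-- `A` is a `β`-competitive online group Steiner forest algorithm on the weighted graph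
`(G, w)`: it maps each request sequence of pairs to an edge set, is monotone under
one-step extensions, always maintains a feasible solution, and its cost is at most `β`
times the cost of any (hence the optimal) offline feasible solution. -/
def IsOnlineGSF {V : Type*} (G : SimpleGraph V) (w : Sym2 V → ℝ) (β : ℝ)
    (A : List (Set V × Set V) → Finset (Sym2 V)) : Prop :=
  (∀ (prs : List (Set V × Set V)) (pr : Set V × Set V), GSFValid (prs ++ [pr]) →
    A prs ⊆ A (prs ++ [pr])) ∧
  (∀ prs : List (Set V × Set V), GSFValid prs → GSFFeasible G prs (A prs)) ∧
  (∀ prs : List (Set V × Set V), GSFValid prs → ∀ F : Finset (Sym2 V),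
    GSFFeasible G prs F → ∑ e ∈ A prs, w e ≤ β * ∑ e ∈ F, w e)

/-- The request obtained by replacing each vertex by the set of its copies. -/
def liftPair {V V' : Type*} (copies : V → Set V') (pr : Set V × Set V) : Set V' × Set V' :=
  (⋃ a ∈ pr.1, copies a, ⋃ b ∈ pr.2, copies b)

theorem edgeConn_empty {V : Type*} {u v : V} (h : EdgeConn (∅ : Set (Sym2 V)) u v) : u = v := by
  simpa [EdgeConn] using h

theorem sum_weight_nonneg {V : Type*} {G : SimpleGraph V} {w : Sym2 V → ℝ}
    (hw : ∀ e ∈ G.edgeSet, 1 ≤ w e) {F : Finset (Sym2 V)} (hF : ↑F ⊆ G.edgeSet) :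
    0 ≤ ∑ e ∈ F, w e :=
  Finset.sum_nonneg fun e he => zero_le_one.trans (hw e (hF he))

theorem eq_empty_of_sum_weight_nonpos {V : Type*} {G : SimpleGraph V} {w : Sym2 V → ℝ}
    (hw : ∀ e ∈ G.edgeSet, 1 ≤ w e) {F : Finset (Sym2 V)} (hF : ↑F ⊆ G.edgeSet)
    (h : ∑ e ∈ F, w e ≤ 0) : F = ∅ := by
  by_contra hne
  exact h.not_gt (Finset.sum_pos (fun e he => zero_lt_one.trans_le (hw e (hF he)))
    (Finset.nonempty_iff_ne_empty.mpr hne))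

theorem GSFValid.lift {V V' : Type*} {copies : V → Set V'} (hne : ∀ v, (copies v).Nonempty)
    {prs : List (Set V × Set V)} (h : GSFValid prs) :
    GSFValid (prs.map (liftPair copies)) := by
  intro pr' hpr'
  obtain ⟨pr, hpr, rfl⟩ := List.mem_map.mp hpr'
  obtain ⟨⟨a, ha⟩, b, hb⟩ := h pr hpr
  obtain ⟨a', ha'⟩ := hne a
  obtain ⟨b', hb'⟩ := hne b
  exact ⟨⟨a', Set.mem_biUnion ha ha'⟩, b', Set.mem_biUnion hb hb'⟩

namespace CopyTreeEmbedding

variable {V V' : Type*} {G : SimpleGraph V} {w : Sym2 V → ℝ} {r : V} {α : ℝ}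

theorem feasible_mapTG (emb : CopyTreeEmbedding V V' G w r α) {prs : List (Set V × Set V)}
    {F' : Finset (Sym2 V')} (h : GSFFeasible emb.tree (prs.map (liftPair emb.copies)) F') :
    GSFFeasible G prs (emb.mapTG F') := by
  refine ⟨emb.mapTG_sub F' h.1, fun pr hpr => ?_⟩
  obtain ⟨u', hu', v', hv', hconn⟩ := h.2 _ (List.mem_map_of_mem hpr)
  obtain ⟨u, hu, huu'⟩ := Set.mem_iUnion₂.mp hu'
  obtain ⟨v, hv, hvv'⟩ := Set.mem_iUnion₂.mp hv'
  exact ⟨u, hu, v, hv, emb.conn_TG F' h.1 u v u' v' huu' hvv' hconn⟩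

theorem feasible_mapGT (emb : CopyTreeEmbedding V V' G w r α) {prs : List (Set V × Set V)}
    {F : Finset (Sym2 V)} (h : GSFFeasible G prs F) :
    GSFFeasible emb.tree (prs.map (liftPair emb.copies)) (emb.mapGT F) := by
  refine ⟨emb.mapGT_sub F h.1, fun pr' hpr' => ?_⟩
  obtain ⟨pr, hpr, rfl⟩ := List.mem_map.mp hpr'
  obtain ⟨u, hu, v, hv, hconn⟩ := h.2 pr hpr
  obtain ⟨u', hu', v', hv', hconn'⟩ := emb.conn_GT F h.1 u v hconn
  exact ⟨u', Set.mem_biUnion hu hu', v', Set.mem_biUnion hv hv', hconn'⟩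

theorem tree_cost_nonneg (emb : CopyTreeEmbedding V V' G w r α)
    (hw : ∀ e ∈ G.edgeSet, 1 ≤ w e) {F' : Finset (Sym2 V')} (hF' : ↑F' ⊆ emb.tree.edgeSet) :
    0 ≤ ∑ e ∈ F', emb.w' e :=
  (sum_weight_nonneg hw (emb.mapTG_sub F' hF')).trans (emb.cost_TG F' hF')

/-- If all edge sets of the tree are free, then `G` has no edges. -/
theorem edgeSet_eq_empty_of_tree_cost_nonpos (emb : CopyTreeEmbedding V V' G w r α)
    (hw : ∀ e ∈ G.edgeSet, 1 ≤ w e)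
    (h : ∀ F' : Finset (Sym2 V'), ↑F' ⊆ emb.tree.edgeSet → ∑ e ∈ F', emb.w' e ≤ 0) :
    G.edgeSet = ∅ := by
  refine Set.eq_empty_of_forall_notMem fun e => ?_
  induction e using Sym2.ind with
  | _ u v =>
    intro he
    have huv : G.Adj u v := he
    have hF : ↑({s(u, v)} : Finset (Sym2 V)) ⊆ G.edgeSet := by simpa using huv
    have hadj : (SimpleGraph.fromEdgeSet
        (↑({s(u, v)} : Finset (Sym2 V)) : Set (Sym2 V))).Adj u v := by
      simp [huv.ne]
    obtain ⟨u', hu', v', hv', hconn⟩ := emb.conn_GT _ hF u v hadj.reachable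
    have hsub := emb.mapGT_sub _ hF
    have hconn' := emb.conn_TG _ hsub u v u' v' hu' hv' hconn
    rw [eq_empty_of_sum_weight_nonpos hw (emb.mapTG_sub _ hsub)
      ((emb.cost_TG _ hsub).trans (h _ hsub)), Finset.coe_empty] at hconn'
    exact huv.ne (edgeConn_empty hconn')

end CopyTreeEmbedding

/-- If `(T, φ, π_{G→T}, π_{T→G})` is an `α`-approximate copy tree
embedding of the weighted graph `(G, r)` and there is a `β`-competitive online group
Steiner forest algorithm on the tree `T`, then there is an `(α·β)`-competitive online
group Steiner forest algorithm on `G`. -/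
theorem onlineGSF_of_copyTreeEmbedding {V V' : Type} (G : SimpleGraph V)
    (w : Sym2 V → ℝ) (r : V) (hG : G.Connected) (hw : ∀ e ∈ G.edgeSet, 1 ≤ w e)
    (α β : ℝ) (emb : CopyTreeEmbedding V V' G w r α)
    (hT : ∃ A' : List (Set V' × Set V') → Finset (Sym2 V'),
      IsOnlineGSF emb.tree emb.w' β A') :
    ∃ A : List (Set V × Set V) → Finset (Sym2 V), IsOnlineGSF G w (α * β) A := by
  obtain ⟨A', hmono, hfeas, hcost⟩ := hT
  refine ⟨fun prs => emb.mapTG (A' (prs.map (liftPair emb.copies))),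
    fun prs pr hv => ?_, fun prs hv => ?_, fun prs hv F hF => ?_⟩
  · have hv' := hv.lift emb.copies_nonempty
    simp only [List.map_append, List.map_singleton] at hv' ⊢
    exact emb.mapTG_mono _ _ (hmono _ _ hv')
  · exact emb.feasible_mapTG (hfeas _ (hv.lift emb.copies_nonempty))
  · have hv' := hv.lift emb.copies_nonempty
    have hA' := (hfeas _ hv').1
    rcases le_or_gt 0 β with hβ | hβ
    · calc ∑ e ∈ emb.mapTG (A' (prs.map (liftPair emb.copies))), w e
          ≤ ∑ e ∈ A' (prs.map (liftPair emb.copies)), emb.w' e := emb.cost_TG _ hA'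
        _ ≤ β * ∑ e ∈ emb.mapGT F, emb.w' e := hcost _ hv' _ (emb.feasible_mapGT hF)
        _ ≤ β * (α * ∑ e ∈ F, w e) := mul_le_mul_of_nonneg_left (emb.cost_GT F hF.1) hβ
        _ = α * β * ∑ e ∈ F, w e := by ring
    · -- For `β < 0` the empty instance forces every edge set of the tree to be free.
      have hnil : GSFValid ([] : List (Set V' × Set V')) := by simp [GSFValid]
      have hfree : ∀ F' : Finset (Sym2 V'), ↑F' ⊆ emb.tree.edgeSet →
          ∑ e ∈ F', emb.w' e ≤ 0 := fun F' hF' => by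
        have h0 := emb.tree_cost_nonneg hw (hfeas _ hnil).1
        have h1 := hcost _ hnil F' ⟨hF', by simp⟩
        exact nonpos_of_mul_nonneg_right (h0.trans h1) hβ
      have hE := emb.edgeSet_eq_empty_of_tree_cost_nonpos hw hfree
      have hempty : ∀ H : Finset (Sym2 V), ↑H ⊆ G.edgeSet → H = ∅ := fun H hH => by
        simpa [hE] using hH
      simp [hempty F hF.1, hempty _ (emb.mapTG_sub _ hA')]
end
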